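/- Let t ≥ 4 and 2 ≤ s ≤ t, and let β = ⌊(t+1)/(s+1)⌋. There exists n₀ such that for all n ≥ n₀ the following holds: with G⋆ and K as in the extremal setup, the number of connected components of G⋆ − K having exactly t+1 vertices is at most 2β − 2. -/

import Mathlib

open SimpleGraph

/-- `H` is a minor of `G` (branch-set definition). -/
def MinorOf {α β : Type} (H : SimpleGraph α) (G : SimpleGraph β) : Prop :=
  ∃ φ : α → Set β,
    (∀ a, (G.induce (φ a)).Connected) ∧
    (Pairwise fun a b => Disjoint (φ a) (φ b)) ∧
    (∀ a b, H.Adj a b → ∃ x ∈ φ a, ∃ y ∈ φ b, G.Adj x y)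

/-- Adjacency matrix over ℝ. -/
noncomputable def adjMat {V : Type} [Fintype V] (G : SimpleGraph V) : Matrix V V ℝ :=
  letI := Classical.decRel G.Adj
  SimpleGraph.adjMatrix ℝ G

theorem adjMat_herm {V : Type} [Fintype V] (G : SimpleGraph V) : (adjMat G).IsHermitian := by
  letI := Classical.decRel G.Adj
  ext i j
  simp [adjMat, Matrix.conjTranspose_apply, SimpleGraph.adjMatrix_apply, SimpleGraph.adj_comm]

/-- Spectral radius = largest adjacency eigenvalue. -/
noncomputable def specRad {V : Type} [Fintype V] [DecidableEq V] (G : SimpleGraph V) : ℝ :=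
  ⨆ i, (adjMat_herm G).eigenvalues i

/-- degree -/
noncomputable def deg {V : Type} (G : SimpleGraph V) (v : V) : ℕ := (G.neighborSet v).ncard

/-- number of edges -/
noncomputable def ecard {V : Type} (G : SimpleGraph V) : ℕ := G.edgeSet.ncard

/-- k disjoint copies of G -/
def copies (k : ℕ) {V : Type} (G : SimpleGraph V) : SimpleGraph (Fin k × V) :=
  SimpleGraph.fromRel fun x y => x.1 = y.1 ∧ G.Adj x.2 y.2

/-- disjoint union -/
def gUnion {V W : Type} (G : SimpleGraph V) (H : SimpleGraph W) : SimpleGraph (V ⊕ W) :=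
  SimpleGraph.fromRel fun x y =>
    (∃ a b, x = Sum.inl a ∧ y = Sum.inl b ∧ G.Adj a b) ∨
    (∃ a b, x = Sum.inr a ∧ y = Sum.inr b ∧ H.Adj a b)

/-- join -/
def gJoin {V W : Type} (G : SimpleGraph V) (H : SimpleGraph W) : SimpleGraph (V ⊕ W) :=
  SimpleGraph.fromRel fun x y =>
    (∃ a b, x = Sum.inl a ∧ y = Sum.inl b ∧ G.Adj a b) ∨
    (∃ a b, x = Sum.inr a ∧ y = Sum.inr b ∧ H.Adj a b) ∨
    (∃ a b, x = Sum.inl a ∧ y = Sum.inr b)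

/-- Petersen graph (Kneser graph K(5,2)). -/
def petersen : SimpleGraph {s : Finset (Fin 5) // s.card = 2} :=
  SimpleGraph.fromRel fun a b => Disjoint a.1 b.1

/-- star K_{1,m} -/
def starG (m : ℕ) : SimpleGraph (Fin 1 ⊕ Fin m) := completeBipartiteGraph (Fin 1) (Fin m)

/-- the star forest H_{s,t} -/
def Hst (s t : ℕ) :
    SimpleGraph ((Fin ((t+1)/(s+1) - 1) × (Fin 1 ⊕ Fin s)) ⊕ (Fin 1 ⊕ Fin (t - ((t+1)/(s+1) - 1) * (s+1)))) :=
  gUnion (copies ((t+1)/(s+1) - 1) (starG s)) (starG (t - ((t+1)/(s+1) - 1) * (s+1)))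

/-- subdivide the edge uv of G by a path through k new vertices -/
def subdividePath {V : Type} (G : SimpleGraph V) (u v : V) (k : ℕ) : SimpleGraph (V ⊕ Fin k) :=
  SimpleGraph.fromRel fun x y =>
    (∃ a b, x = Sum.inl a ∧ y = Sum.inl b ∧ G.Adj a b ∧ ¬(a = u ∧ b = v) ∧ ¬(a = v ∧ b = u)) ∨
    (∃ i : Fin k, x = Sum.inl u ∧ y = Sum.inr i ∧ (i : ℕ) = 0) ∨
    (∃ i j : Fin k, x = Sum.inr i ∧ y = Sum.inr j ∧ (j : ℕ) = (i : ℕ) + 1) ∨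
    (∃ i : Fin k, x = Sum.inr i ∧ y = Sum.inl v ∧ (i : ℕ) = k - 1)

/-- (s,t)-property -/
def HasSTProp (s t : ℕ) {V : Type} (G : SimpleGraph V) : Prop :=
  ∀ a b : ℕ, 1 ≤ a → 1 ≤ b → a + b = t + 1 → a ≤ min s ((t+1)/2) →
    ¬ MinorOf (completeBipartiteGraph (Fin a) (Fin b)) G

/-- H_{a,b,c} -/
def Habc (a b c : ℕ) : SimpleGraph (Fin 3 ⊕ (Fin a ⊕ Fin b ⊕ Fin c)) :=
  SimpleGraph.fromRel fun x y =>
    (x = Sum.inl 0 ∧ y = Sum.inl 1) ∨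
    (x = Sum.inl 0 ∧ ∃ i : Fin a, y = Sum.inr (Sum.inl i)) ∨
    (x = Sum.inl 0 ∧ ∃ i : Fin b, y = Sum.inr (Sum.inr (Sum.inl i))) ∨
    (x = Sum.inl 1 ∧ ∃ i : Fin a, y = Sum.inr (Sum.inl i)) ∨
    (x = Sum.inl 1 ∧ ∃ i : Fin c, y = Sum.inr (Sum.inr (Sum.inr i))) ∨
    (x = Sum.inl 2 ∧ ∃ i : Fin b, y = Sum.inr (Sum.inr (Sum.inl i))) ∨
    (x = Sum.inl 2 ∧ ∃ i : Fin c, y = Sum.inr (Sum.inr (Sum.inr i)))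

noncomputable def edgeDegSum {V : Type} (G H : SimpleGraph V) : ℕ :=
  ∑ᶠ e ∈ G.edgeSet, Sym2.lift ⟨fun u v => deg H u + deg H v, fun u v => by dsimp; ring⟩ e

open Matrix in
theorem specRad_psd {V : Type} [Fintype V] [DecidableEq V] (G : SimpleGraph V) :
    (specRad G • (1 : Matrix V V ℝ) - adjMat G).PosSemidef := by
  have hH : (specRad G • (1 : Matrix V V ℝ) - adjMat G).IsHermitian := by
    apply Matrix.IsHermitian.sub _ (adjMat_herm G)
    ext i j
    simp [Matrix.one_apply, eq_comm]
  rw [hH.posSemidef_iff_eigenvalues_nonneg]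
  intro i
  have h := hH.eigenvalues_mem_spectrum_real i
  have h2 : specRad G - hH.eigenvalues i ∈ spectrum ℝ (adjMat G) := by
    rw [spectrum.mem_iff] at h ⊢
    intro h3
    apply h
    have : (algebraMap ℝ (Matrix V V ℝ)) (hH.eigenvalues i) - (specRad G • (1 : Matrix V V ℝ) - adjMat G)
      = - ((algebraMap ℝ (Matrix V V ℝ)) (specRad G - hH.eigenvalues i) - adjMat G) := by
      rw [Algebra.algebraMap_eq_smul_one, Algebra.algebraMap_eq_smul_one, sub_smul]
      abel
    rw [this]
    exact h3.neg
  rw [(adjMat_herm G).spectrum_real_eq_range_eigenvalues] at h2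
  obtain ⟨j, hj⟩ := h2
  have : (adjMat_herm G).eigenvalues j ≤ specRad G :=
    le_ciSup (f := (adjMat_herm G).eigenvalues) (Set.finite_range _).bddAbove j
  show 0 ≤ hH.eigenvalues i
  linarith

theorem adjMat_nonneg {V : Type} [Fintype V] (G : SimpleGraph V) (u v : V) : 0 ≤ adjMat G u v := by
  classical
  unfold adjMat
  rw [SimpleGraph.adjMatrix_apply]
  split_ifs <;> norm_num

theorem adjMat_le_one {V : Type} [Fintype V] (G : SimpleGraph V) (u v : V) : adjMat G u v ≤ 1 := by
  classical
  unfold adjMat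
  rw [SimpleGraph.adjMatrix_apply]
  split_ifs <;> norm_num

theorem adjMat_symm {V : Type} [Fintype V] (G : SimpleGraph V) (u v : V) :
    adjMat G u v = adjMat G v u := by
  classical
  unfold adjMat
  simp [SimpleGraph.adjMatrix_apply, SimpleGraph.adj_comm]

theorem adjMat_adj {V : Type} [Fintype V] (G : SimpleGraph V) {u v : V} (h : G.Adj u v) :
    adjMat G u v = 1 := by
  classical
  unfold adjMat
  simp [SimpleGraph.adjMatrix_apply, h]

theorem adjMat_not_adj {V : Type} [Fintype V] (G : SimpleGraph V) {u v : V} (h : ¬ G.Adj u v) :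
    adjMat G u v = 0 := by
  classical
  unfold adjMat
  simp [SimpleGraph.adjMatrix_apply, h]

/-- Rayleigh bound, in sum form. -/
theorem rayleigh {V : Type} [Fintype V] [DecidableEq V] (G : SimpleGraph V) (y : V → ℝ) :
    ∑ u, ∑ v, adjMat G u v * (y u * y v) ≤ specRad G * ∑ v, y v ^ 2 := by
  have h := (specRad_psd G).dotProduct_mulVec_nonneg y
  have e : star y ⬝ᵥ ((specRad G • (1 : Matrix V V ℝ) - adjMat G).mulVec y)
      = specRad G * ∑ v, y v ^ 2 - ∑ u, ∑ v, adjMat G u v * (y u * y v) := by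
    rw [Matrix.sub_mulVec, Matrix.smul_mulVec, Matrix.one_mulVec, dotProduct_sub]
    congr 1
    · simp only [dotProduct, Pi.star_apply, star_trivial, Pi.smul_apply, smul_eq_mul, Finset.mul_sum]
      exact Finset.sum_congr rfl fun v _ => by ring
    · simp only [dotProduct, Pi.star_apply, star_trivial, Matrix.mulVec, Finset.mul_sum]
      exact Finset.sum_congr rfl fun v _ => Finset.sum_congr rfl fun w _ => by ring
  rw [e] at h
  linarith

/-- a nonnegative eigenvector. -/
theorem exists_perron {V : Type} [Fintype V] [DecidableEq V] [Nonempty V] (G : SimpleGraph V) :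
    ∃ x : V → ℝ, (∀ v, 0 ≤ x v) ∧ x ≠ 0 ∧ ∀ u, ∑ v, adjMat G u v * x v = specRad G * x u := by
  obtain ⟨i, hi⟩ := exists_eq_ciSup_of_finite (f := (adjMat_herm G).eigenvalues)
  have hi' : (adjMat_herm G).eigenvalues i = specRad G := hi
  set w : V → ℝ := ⇑((adjMat_herm G).eigenvectorBasis i) with hw
  have hw0 : w ≠ 0 := by
    intro h
    have := (adjMat_herm G).eigenvectorBasis.toBasis.ne_zero i
    apply this
    rw [OrthonormalBasis.coe_toBasis]
    ext v
    exact congrFun h v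
  have hev : ∀ u, ∑ v, adjMat G u v * w v = specRad G * w u := by
    intro u
    have := congrFun ((adjMat_herm G).mulVec_eigenvectorBasis i) u
    rw [hi'] at this
    simpa [Matrix.mulVec, dotProduct] using this
  have hx : ∑ u, ∑ v, adjMat G u v * (|w u| * |w v|) = specRad G * ∑ v, |w v| ^ 2 := by
    apply le_antisymm (rayleigh G fun v => |w v|)
    calc specRad G * ∑ v, |w v| ^ 2 = ∑ u, w u * ∑ v, adjMat G u v * w v := by
          simp_rw [hev, sq_abs, Finset.mul_sum]
          exact Finset.sum_congr rfl fun v _ => by ring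
      _ ≤ _ := by
          apply Finset.sum_le_sum
          intro u _
          rw [Finset.mul_sum]
          apply Finset.sum_le_sum
          intro v _
          have h1 := adjMat_nonneg G u v
          have h2 : w u * w v ≤ |w u| * |w v| := by rw [← abs_mul]; exact le_abs_self _
          nlinarith
  refine ⟨fun v => |w v|, fun v => abs_nonneg _, ?_, ?_⟩
  · intro h
    apply hw0
    funext v
    simpa using congrFun h v
  · intro u
    have h := ((specRad_psd G).dotProduct_mulVec_zero_iff (fun v => |w v|)).1 ?_
    · have h2 := congrFun h u
      rw [Matrix.sub_mulVec, Matrix.smul_mulVec, Matrix.one_mulVec] at h2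
      simp only [Pi.sub_apply, Pi.smul_apply, smul_eq_mul, Pi.zero_apply, Matrix.mulVec, dotProduct] at h2
      linarith
    · rw [Matrix.sub_mulVec, Matrix.smul_mulVec, Matrix.one_mulVec, dotProduct_sub, sub_eq_zero]
      simp only [dotProduct, Pi.star_apply, star_trivial, Matrix.mulVec, Pi.smul_apply, smul_eq_mul]
      calc _ = specRad G * ∑ v, |w v| ^ 2 := by
            rw [Finset.mul_sum]
            exact Finset.sum_congr rfl fun v _ => by ring
        _ = _ := by
            rw [← hx]
            simp_rw [Finset.mul_sum]
            exact Finset.sum_congr rfl fun v _ => Finset.sum_congr rfl fun w _ => by ring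
theorem specRad_lower {V : Type} [Fintype V] [DecidableEq V] (G : SimpleGraph V) (k : V)
    (hk : ∀ v, v ≠ k → G.Adj k v) (R : ℝ) (hR : 0 < R)
    (hn : R ^ 2 ≤ (Fintype.card V : ℝ) - 1) : R ≤ specRad G := by
  have h := rayleigh G (fun v => if v = k then R else 1)
  have e1 : ∑ v : V, (if v = k then R else (1:ℝ)) ^ 2 = R ^ 2 + (Fintype.card V - 1) := by
    rw [← Finset.add_sum_erase _ _ (Finset.mem_univ k)]
    rw [Finset.sum_congr rfl (g := fun _ => (1:ℝ)) (fun v hv => by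
      simp [Finset.ne_of_mem_erase hv])]
    have : 1 ≤ Fintype.card V := Fintype.card_pos_iff.2 ⟨k⟩
    simp [Finset.card_erase_of_mem, Nat.cast_sub this]
  have e2 : 2 * R * ((Fintype.card V : ℝ) - 1) ≤
      ∑ u, ∑ v, adjMat G u v * ((if u = k then R else (1:ℝ)) * (if v = k then R else (1:ℝ))) := by
    have hc : ((Finset.univ.erase k).card : ℝ) = (Fintype.card V : ℝ) - 1 := by
      have : 1 ≤ Fintype.card V := Fintype.card_pos_iff.2 ⟨k⟩
      simp [Finset.card_erase_of_mem, Nat.cast_sub this]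
    have hpos : ∀ u v, 0 ≤ adjMat G u v * ((if u = k then R else (1:ℝ)) * (if v = k then R else (1:ℝ))) := by
      intro u v
      apply mul_nonneg (adjMat_nonneg _ _ _)
      apply mul_nonneg <;> split_ifs <;> linarith
    rw [← Finset.add_sum_erase _ _ (Finset.mem_univ k)]
    have a1 : R * ((Fintype.card V : ℝ) - 1) ≤ ∑ v, adjMat G k v * ((if k = k then R else (1:ℝ)) * (if v = k then R else (1:ℝ))) := by
      calc R * ((Fintype.card V : ℝ) - 1) = ∑ v ∈ Finset.univ.erase k, R := by
            rw [Finset.sum_const, nsmul_eq_mul, hc, mul_comm]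
        _ ≤ ∑ v ∈ Finset.univ.erase k, adjMat G k v * ((if k = k then R else (1:ℝ)) * (if v = k then R else (1:ℝ))) := by
            apply Finset.sum_le_sum
            intro v hv
            have hv' := Finset.ne_of_mem_erase hv
            rw [adjMat_adj G (hk v hv')]
            simp [hv']
        _ ≤ _ := Finset.sum_le_sum_of_subset_of_nonneg (Finset.erase_subset _ _) (fun v _ _ => hpos k v)
    have a2 : R * ((Fintype.card V : ℝ) - 1) ≤ ∑ u ∈ Finset.univ.erase k, ∑ v, adjMat G u v * ((if u = k then R else (1:ℝ)) * (if v = k then R else (1:ℝ))) := by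
      calc R * ((Fintype.card V : ℝ) - 1) = ∑ v ∈ Finset.univ.erase k, R := by
            rw [Finset.sum_const, nsmul_eq_mul, hc, mul_comm]
        _ ≤ _ := by
            apply Finset.sum_le_sum
            intro u hu
            have hu' := Finset.ne_of_mem_erase hu
            have := Finset.single_le_sum (f := fun v => adjMat G u v * ((if u = k then R else (1:ℝ)) * (if v = k then R else (1:ℝ)))) (fun v _ => hpos u v) (Finset.mem_univ k)
            refine le_trans ?_ this
            simp [hu', adjMat_adj G (hk u hu').symm]
    linarith
  rw [e1] at h
  have h3 := le_trans e2 h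
  by_contra hlt
  push Not at hlt
  have hp : 0 < R ^ 2 := by positivity
  nlinarith

theorem perron_est {V : Type} [Fintype V] [DecidableEq V] [Nonempty V] (G : SimpleGraph V)
    (K : Finset V) (D : ℝ) (hD : 0 ≤ D)
    (hdom : ∀ v : V, v ∉ K → ∀ u ∈ K, G.Adj u v)
    (hdeg : ∀ v, v ∉ K → ∑ u ∈ Kᶜ, adjMat G v u ≤ D)
    (hρ : 2 * D + 1 ≤ specRad G) :
    ∃ x ξ : V → ℝ, (∀ u, ∑ v, adjMat G u v * x v = specRad G * x u) ∧
      (∀ v, v ∉ K → x v = 1 + ξ v / specRad G) ∧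
      (∀ v, v ∉ K → 0 ≤ ξ v ∧ ξ v ≤ 2 * D) ∧
      (∀ v, v ∉ K → ∃ η, 0 ≤ η ∧ η ≤ 2 * D ^ 2 ∧
        ξ v = (∑ u ∈ Kᶜ, adjMat G v u) + η / specRad G) := by
  obtain ⟨x, hx0, hxne, hx⟩ := exists_perron G
  set ρ := specRad G with hρdef
  have hρ0 : 0 < ρ := by linarith
  have hrow : ∀ (x : V → ℝ) v, v ∉ K → ∑ u, adjMat G v u * x u = ∑ u ∈ K, x u + ∑ u ∈ Kᶜ, adjMat G v u * x u := by
    intro x v hv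
    rw [← Finset.sum_add_sum_compl K]
    congr 1
    apply Finset.sum_congr rfl
    intro u hu
    rw [adjMat_adj G (hdom v hv u hu).symm, one_mul]
  have hbd : ∀ (x : V → ℝ) (M : ℝ) v, v ∉ K → 0 ≤ M → (∀ u, u ∉ K → x u ≤ M) → ∑ u ∈ Kᶜ, adjMat G v u * x u ≤ D * M := by
    intro x M v hv hM hxM
    calc ∑ u ∈ Kᶜ, adjMat G v u * x u ≤ ∑ u ∈ Kᶜ, adjMat G v u * M := by
          apply Finset.sum_le_sum
          intro u hu
          exact mul_le_mul_of_nonneg_left (hxM u (Finset.mem_compl.1 hu)) (adjMat_nonneg _ _ _)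
      _ = (∑ u ∈ Kᶜ, adjMat G v u) * M := by rw [Finset.sum_mul]
      _ ≤ D * M := mul_le_mul_of_nonneg_right (hdeg v hv) hM
  have hX : 0 < ∑ u ∈ K, x u := by
    by_contra hneg
    have hX0 : ∑ u ∈ K, x u = 0 := le_antisymm (not_lt.1 hneg) (Finset.sum_nonneg fun u _ => hx0 u)
    obtain ⟨v, hv⟩ := Finite.exists_max x
    have hpos : 0 < x v := by
      by_contra h
      apply hxne
      funext u
      exact le_antisymm ((hv u).trans (not_lt.1 h)) (hx0 u)
    have hvK : v ∉ K := by
      intro h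
      have := (Finset.sum_eq_zero_iff_of_nonneg (fun u _ => hx0 u)).1 hX0 v h
      linarith
    have h1 := hx v
    rw [hrow x v hvK, hX0] at h1
    have h2 := hbd x (x v) v hvK hpos.le (fun u _ => hv u)
    nlinarith
  set X := ∑ u ∈ K, x u
  let y : V → ℝ := fun v => ρ / X * x v
  have hy0 : ∀ v, 0 ≤ y v := fun v => mul_nonneg (by positivity) (hx0 v)
  have hyK : ∑ u ∈ K, y u = ρ := by
    simp only [y]
    rw [← Finset.mul_sum]
    field_simp
    rfl
  have hy : ∀ u, ∑ v, adjMat G u v * y v = ρ * y u := by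
    intro u
    simp only [y]
    calc _ = ρ / X * ∑ v, adjMat G u v * x v := by
          rw [Finset.mul_sum]
          exact Finset.sum_congr rfl fun v _ => by ring
      _ = _ := by rw [hx]; ring
  let ξ : V → ℝ := fun v => ∑ u ∈ Kᶜ, adjMat G v u * y u
  have hyξ : ∀ v, v ∉ K → y v = 1 + ξ v / ρ := by
    intro v hv
    have h1 := hy v
    rw [hrow y v hv, hyK] at h1
    simp only [ξ]
    field_simp
    linarith
  have hy2 : ∀ v, v ∉ K → y v ≤ 2 := by
    by_cases hne : (Kᶜ).Nonempty
    · obtain ⟨w, hw, hmax⟩ := Finset.exists_max_image Kᶜ y hne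
      have hwK := Finset.mem_compl.1 hw
      have h1 := hy w
      rw [hrow y w hwK, hyK] at h1
      have h2 := hbd y (y w) w hwK (hy0 w) (fun u hu => hmax u (Finset.mem_compl.2 hu))
      have : y w ≤ 2 := by
        by_contra h
        push Not at h
        nlinarith
      intro v hv
      exact (hmax v (Finset.mem_compl.2 hv)).trans this
    · intro v hv
      exact absurd ⟨v, Finset.mem_compl.2 hv⟩ hne
  have hξ0 : ∀ v, 0 ≤ ξ v := fun v => Finset.sum_nonneg fun u _ => mul_nonneg (adjMat_nonneg _ _ _) (hy0 u)
  have hξ2 : ∀ v, v ∉ K → ξ v ≤ 2 * D := by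
    intro v hv
    have := hbd y 2 v hv (by norm_num) hy2
    simp only [ξ]
    linarith
  refine ⟨y, ξ, hy, hyξ, fun v hv => ⟨hξ0 v, hξ2 v hv⟩, ?_⟩
  intro v hv
  refine ⟨∑ u ∈ Kᶜ, adjMat G v u * ξ u, Finset.sum_nonneg fun u _ => mul_nonneg (adjMat_nonneg _ _ _) (hξ0 u), ?_, ?_⟩
  · have := hbd ξ (2 * D) v hv (by positivity) hξ2
    nlinarith
  · rw [Finset.sum_div, ← Finset.sum_add_distrib]
    simp only [ξ]
    apply Finset.sum_congr rfl
    intro u hu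
    rw [hyξ u (Finset.mem_compl.1 hu)]
    simp only [ξ]
    ring

theorem sum_abs_bound {V : Type} (S : Finset V) (f : V → V → ℝ) (C : ℝ)
    (h : ∀ u ∈ S, ∀ v ∈ S, |f u v| ≤ C) : -((S.card : ℝ) ^ 2 * C) ≤ ∑ u ∈ S, ∑ v ∈ S, f u v := by
  have : ∑ u ∈ S, ∑ v ∈ S, (-C) ≤ ∑ u ∈ S, ∑ v ∈ S, f u v :=
    Finset.sum_le_sum fun u hu => Finset.sum_le_sum fun v hv => (abs_le.1 (h u hu v hv)).1
  simp only [Finset.sum_const, nsmul_eq_mul] at this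
  linarith

set_option maxHeartbeats 1000000 in
theorem spectral_compare {V : Type} [Fintype V] [DecidableEq V] [Nonempty V] (G G' : SimpleGraph V)
    (K S : Finset V) (D N : ℝ) (hD : 0 ≤ D)
    (hdom : ∀ v : V, v ∉ K → ∀ u ∈ K, G.Adj u v)
    (hdeg : ∀ v, v ∉ K → ∑ u ∈ Kᶜ, adjMat G v u ≤ D)
    (hSK : ∀ v ∈ S, v ∉ K)
    (hSc : ∀ v ∈ S, ∀ u, G.Adj v u → u ∈ K ∨ u ∈ S)
    (hGG : ∀ u v, ¬ (u ∈ S ∧ v ∈ S) → (G'.Adj u v ↔ G.Adj u v))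
    (hN : (S.card : ℝ) = N)
    (hρ : 2 * D + 1 + N ^ 3 + (N ^ 2 * (2 * D + N) ^ 2 + N ^ 2 * N ^ 2 + N * (N * (4 * D ^ 2))) < specRad G)
    (hsum : (∑ v ∈ S, ∑ u ∈ S, adjMat G v u) + 1 ≤ (∑ v ∈ S, ∑ u ∈ S, adjMat G' v u) ∨
      ((∑ v ∈ S, ∑ u ∈ S, adjMat G v u) = (∑ v ∈ S, ∑ u ∈ S, adjMat G' v u) ∧
       (∑ v ∈ S, (∑ u ∈ S, adjMat G v u) ^ 2) + 1 ≤ (∑ v ∈ S, (∑ u ∈ S, adjMat G' v u) ^ 2))) :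
    specRad G < specRad G' := by
  have hN0 : 0 ≤ N := by rw [← hN]; positivity
  have hE0 : 0 ≤ N ^ 2 * (2 * D + N) ^ 2 + N ^ 2 * N ^ 2 + N * (N * (4 * D ^ 2)) := by positivity
  set E := N ^ 2 * (2 * D + N) ^ 2 + N ^ 2 * N ^ 2 + N * (N * (4 * D ^ 2)) with hE
  have hN3 : 0 ≤ N ^ 3 := by positivity
  obtain ⟨x, ξ, hx, hxξ, hξ, hη⟩ := perron_est G K D hD hdom hdeg (by linarith)
  set ρ := specRad G with hρdef
  have hρ0 : 0 < ρ := by linarith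
  have hdS : ∀ v ∈ S, ∑ u ∈ Kᶜ, adjMat G v u = ∑ u ∈ S, adjMat G v u := by
    intro v hv
    symm
    apply Finset.sum_subset
    · intro u hu
      exact Finset.mem_compl.2 (hSK u hu)
    · intro u hu hu2
      apply adjMat_not_adj
      intro h
      rcases hSc v hv u h with h | h
      · exact Finset.mem_compl.1 hu h
      · exact hu2 h
  set A := adjMat G
  set A' := adjMat G'
  set d : V → ℝ := fun v => ∑ u ∈ S, A v u with hd
  set d' : V → ℝ := fun v => ∑ u ∈ S, A' v u with hd'
  have hdr : ∀ v, 0 ≤ d v ∧ d v ≤ N := by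
    intro v
    refine ⟨Finset.sum_nonneg fun u _ => adjMat_nonneg _ _ _, ?_⟩
    calc d v ≤ ∑ u ∈ S, 1 := Finset.sum_le_sum fun u _ => adjMat_le_one _ _ _
      _ = N := by simp [hN]
  have hdr' : ∀ v, 0 ≤ d' v ∧ d' v ≤ N := by
    intro v
    refine ⟨Finset.sum_nonneg fun u _ => adjMat_nonneg _ _ _, ?_⟩
    calc d' v ≤ ∑ u ∈ S, 1 := Finset.sum_le_sum fun u _ => adjMat_le_one _ _ _
      _ = N := by simp [hN]
  set c : V → ℝ := fun v => d' v - d v with hc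
  have hcN : ∀ v, |c v| ≤ N := by
    intro v
    rw [abs_le]
    have h1 := hdr v
    have h2 := hdr' v
    simp only [hc]
    constructor <;> linarith [h1.1, h1.2, h2.1, h2.2]
  set z : V → ℝ := fun v => if v ∈ S then c v / ρ else 0 with hz
  have hray := rayleigh G' (fun v => x v + z v)
  have hB : ∑ u, ∑ v, A' u v * ((x u + z u) * (x v + z v))
      = ∑ u, ∑ v, A u v * ((x u + z u) * (x v + z v))
        + ∑ u ∈ S, ∑ v ∈ S, (A' u v - A u v) * ((x u + z u) * (x v + z v)) := by
    have : ∑ u ∈ S, ∑ v ∈ S, (A' u v - A u v) * ((x u + z u) * (x v + z v))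
        = ∑ u, ∑ v, (A' u v - A u v) * ((x u + z u) * (x v + z v)) := by
      have hzero : ∀ u v, ¬ (u ∈ S ∧ v ∈ S) → A' u v - A u v = 0 := by
        intro u v h
        show adjMat G' u v - adjMat G u v = 0
        by_cases ha : G.Adj u v
        · rw [adjMat_adj G ha, adjMat_adj G' ((hGG u v h).2 ha), sub_self]
        · rw [adjMat_not_adj G ha, adjMat_not_adj G' (fun h' => ha ((hGG u v h).1 h')), sub_self]
      calc _ = ∑ u ∈ S, ∑ v, (A' u v - A u v) * ((x u + z u) * (x v + z v)) := by
            apply Finset.sum_congr rfl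
            intro u _
            apply Finset.sum_subset (Finset.subset_univ _)
            intro v _ hv
            rw [hzero u v (fun h => hv h.2), zero_mul]
        _ = _ := by
            apply Finset.sum_subset (Finset.subset_univ _)
            intro u _ hu
            apply Finset.sum_eq_zero
            intro v _
            rw [hzero u v (fun h => hu h.1), zero_mul]
    rw [this, ← Finset.sum_add_distrib]
    apply Finset.sum_congr rfl
    intro u _
    rw [← Finset.sum_add_distrib]
    exact Finset.sum_congr rfl fun v _ => by ring
  have hA : ∑ u, ∑ v, A u v * ((x u + z u) * (x v + z v))
      = ρ * ∑ v, (x v + z v) ^ 2 + ∑ u ∈ S, ∑ v ∈ S, A u v * (z u * z v) - ρ * ∑ v ∈ S, z v ^ 2 := by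
    have e1 : ∑ u, ∑ v, A u v * (x u * x v) = ρ * ∑ v, x v ^ 2 := by
      rw [Finset.mul_sum]
      apply Finset.sum_congr rfl
      intro u _
      calc _ = x u * ∑ v, A u v * x v := by
            rw [Finset.mul_sum]
            exact Finset.sum_congr rfl fun v _ => by ring
        _ = _ := by rw [hx]; ring
    have e2 : ∑ u, ∑ v, A u v * (z u * x v) = ρ * ∑ v, z v * x v := by
      rw [Finset.mul_sum]
      apply Finset.sum_congr rfl
      intro u _
      calc _ = z u * ∑ v, A u v * x v := by
            rw [Finset.mul_sum]
            exact Finset.sum_congr rfl fun v _ => by ring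
        _ = _ := by rw [hx]; ring
    have e3 : ∑ u, ∑ v, A u v * (x u * z v) = ρ * ∑ v, z v * x v := by
      rw [← e2, Finset.sum_comm]
      apply Finset.sum_congr rfl
      intro u _
      apply Finset.sum_congr rfl
      intro v _
      rw [show A v u = A u v from adjMat_symm G v u]
      ring
    have e4 : ∑ u, ∑ v, A u v * (z u * z v) = ∑ u ∈ S, ∑ v ∈ S, A u v * (z u * z v) := by
      symm
      calc _ = ∑ u ∈ S, ∑ v, A u v * (z u * z v) := by
            apply Finset.sum_congr rfl
            intro u _
            apply Finset.sum_subset (Finset.subset_univ _)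
            intro v _ hv
            simp [hz, hv]
        _ = _ := by
            apply Finset.sum_subset (Finset.subset_univ _)
            intro u _ hu
            apply Finset.sum_eq_zero
            intro v _
            simp [hz, hu]
    have e5 : ∑ v ∈ S, z v ^ 2 = ∑ v, z v ^ 2 := by
      apply Finset.sum_subset (Finset.subset_univ _)
      intro v _ hv
      simp [hz, hv]
    rw [e5, ← e4]
    have e6 : ∑ v, (x v + z v) ^ 2 = ∑ v, x v ^ 2 + 2 * ∑ v, z v * x v + ∑ v, z v ^ 2 := by
      rw [Finset.mul_sum, ← Finset.sum_add_distrib, ← Finset.sum_add_distrib]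
      exact Finset.sum_congr rfl fun v _ => by ring
    have e7 : ∑ u, ∑ v, A u v * ((x u + z u) * (x v + z v)) = ∑ u, ∑ v, A u v * (x u * x v)
        + ∑ u, ∑ v, A u v * (z u * x v) + ∑ u, ∑ v, A u v * (x u * z v) + ∑ u, ∑ v, A u v * (z u * z v) := by
      simp only [← Finset.sum_add_distrib]
      exact Finset.sum_congr rfl fun v _ => Finset.sum_congr rfl fun v _ => by ring
    rw [e7, e6, e1, e2, e3]
    ring
  have hxz : ∀ v ∈ S, x v + z v = 1 + (ξ v + c v) / ρ := by
    intro v hv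
    rw [hxξ v (hSK v hv)]
    simp only [hz, if_pos hv]
    ring
  have hzS : ∀ v ∈ S, z v = c v / ρ := fun v hv => by simp only [hz, if_pos hv]
  have hBy : ∑ u ∈ S, ∑ v ∈ S, (A' u v - A u v) * ((x u + z u) * (x v + z v))
      = (∑ u ∈ S, c u) + (2 / ρ) * (∑ u ∈ S, c u * (ξ u + c u))
        + (1 / ρ ^ 2) * ∑ u ∈ S, ∑ v ∈ S, (A' u v - A u v) * ((ξ u + c u) * (ξ v + c v)) := by
    have f1 : ∑ u ∈ S, ∑ v ∈ S, (A' u v - A u v) = ∑ u ∈ S, c u := by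
      apply Finset.sum_congr rfl
      intro u _
      simp only [hc, hd, hd', Finset.sum_sub_distrib]
    have f2 : ∑ u ∈ S, ∑ v ∈ S, (A' u v - A u v) * (ξ u + c u) = ∑ u ∈ S, c u * (ξ u + c u) := by
      apply Finset.sum_congr rfl
      intro u _
      rw [← Finset.sum_mul]
      simp only [hc, hd, hd', Finset.sum_sub_distrib]
    have f3 : ∑ u ∈ S, ∑ v ∈ S, (A' u v - A u v) * (ξ v + c v) = ∑ u ∈ S, c u * (ξ u + c u) := by
      rw [← f2, Finset.sum_comm]
      apply Finset.sum_congr rfl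
      intro u _
      apply Finset.sum_congr rfl
      intro v _
      rw [show A v u = A u v from adjMat_symm G v u, show A' v u = A' u v from adjMat_symm G' v u]
    calc _ = ∑ u ∈ S, ∑ v ∈ S, ((A' u v - A u v) + (1 / ρ) * ((A' u v - A u v) * (ξ u + c u))
          + (1 / ρ) * ((A' u v - A u v) * (ξ v + c v))
          + (1 / ρ ^ 2) * ((A' u v - A u v) * ((ξ u + c u) * (ξ v + c v)))) := by
          apply Finset.sum_congr rfl
          intro u hu
          apply Finset.sum_congr rfl
          intro v hv
          rw [hxz u hu, hxz v hv]
          field_simp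
          ring
      _ = _ := by
          simp only [Finset.sum_add_distrib, ← Finset.mul_sum]
          rw [f1, f2, f3]
          ring
  have hAz : ∑ u ∈ S, ∑ v ∈ S, A u v * (z u * z v) = (1 / ρ ^ 2) * ∑ u ∈ S, ∑ v ∈ S, A u v * (c u * c v) := by
    simp only [Finset.mul_sum]
    apply Finset.sum_congr rfl
    intro u hu
    apply Finset.sum_congr rfl
    intro v hv
    rw [hzS u hu, hzS v hv]
    field_simp
  have hzz : ρ * ∑ v ∈ S, z v ^ 2 = (1 / ρ) * ∑ v ∈ S, c v ^ 2 := by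
    simp only [Finset.mul_sum]
    apply Finset.sum_congr rfl
    intro v hv
    rw [hzS v hv]
    field_simp
  have hξ' : ∀ v ∈ S, |ξ v + c v| ≤ 2 * D + N := by
    intro v hv
    have h1 := hξ v (hSK v hv)
    have h2 := abs_le.1 (hcN v)
    rw [abs_le]
    constructor <;> linarith [h1.1, h1.2, h2.1, h2.2]
  have b1 : -(N ^ 2 * (2 * D + N) ^ 2) ≤ ∑ u ∈ S, ∑ v ∈ S, (A' u v - A u v) * ((ξ u + c u) * (ξ v + c v)) := by
    rw [← hN]
    rw [← hN] at hξ'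
    apply sum_abs_bound
    intro u hu v hv
    rw [abs_mul, abs_mul]
    have h1 : |A' u v - A u v| ≤ 1 := by
      have := adjMat_nonneg G u v
      have := adjMat_nonneg G' u v
      have := adjMat_le_one G u v
      have := adjMat_le_one G' u v
      rw [abs_le]; constructor <;> simp only [A, A'] <;> linarith
    have h2 := hξ' u hu
    have h3 := hξ' v hv
    calc _ ≤ 1 * ((2 * D + S.card) * (2 * D + S.card)) := by gcongr
      _ = _ := by ring
  have b2 : -(N ^ 2 * N ^ 2) ≤ ∑ u ∈ S, ∑ v ∈ S, A u v * (c u * c v) := by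
    rw [← hN]
    rw [← hN] at hcN
    apply sum_abs_bound
    intro u hu v hv
    rw [abs_mul, abs_mul]
    have h1 : |A u v| ≤ 1 := by
      have := adjMat_nonneg G u v
      have := adjMat_le_one G u v
      rw [abs_le]; constructor <;> simp only [A] <;> linarith
    have h2 := hcN u
    have h3 := hcN v
    calc _ ≤ 1 * ((S.card : ℝ) * S.card) := by gcongr
      _ = _ := by ring
  have b3 : (∑ v ∈ S, d' v ^ 2 - ∑ v ∈ S, d v ^ 2) - N * (N * (4 * D ^ 2)) / ρ ≤
      2 * (∑ u ∈ S, c u * (ξ u + c u)) - ∑ v ∈ S, c v ^ 2 := by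
    have : ∑ v ∈ S, (d' v ^ 2 - d v ^ 2 - (N * (4 * D ^ 2)) / ρ) ≤ ∑ v ∈ S, (2 * (c v * (ξ v + c v)) - c v ^ 2) := by
      apply Finset.sum_le_sum
      intro v hv
      obtain ⟨η, h0, h1, h2⟩ := hη v (hSK v hv)
      rw [hdS v hv] at h2
      have h2' : ξ v = d v + η / ρ := h2
      rw [h2']
      have h3 : 2 * (c v * (d v + η / ρ + c v)) - c v ^ 2 = d' v ^ 2 - d v ^ 2 + 2 * c v * η / ρ := by
        simp only [hc]; ring
      rw [h3]
      have h4 : -(N * (4 * D ^ 2)) / ρ ≤ 2 * c v * η / ρ := by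
        apply div_le_div_of_nonneg_right _ hρ0.le
        have h5 := abs_le.1 (hcN v)
        have h6 := mul_le_mul_of_nonneg_right h5.1 h0
        have h7 := mul_le_mul_of_nonneg_left h1 hN0
        linarith only [h6, h7]
      rw [neg_div] at h4
      linarith
    simp only [Finset.sum_sub_distrib, Finset.sum_const, nsmul_eq_mul, hN, ← Finset.mul_sum] at this
    calc _ = ∑ v ∈ S, d' v ^ 2 - ∑ v ∈ S, d v ^ 2 - N * (N * (4 * D ^ 2) / ρ) := by ring
      _ ≤ _ := this
  rw [hB, hA, hBy, hAz, hzz] at hray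
  have hx2 : 0 ≤ ∑ v, (x v + z v) ^ 2 := Finset.sum_nonneg fun v _ => sq_nonneg _
  have hcs : ∑ u ∈ S, c u = ∑ v ∈ S, d' v - ∑ v ∈ S, d v := by simp only [hc, Finset.sum_sub_distrib]
  set P := ∑ v ∈ S, d' v ^ 2 - ∑ v ∈ S, d v ^ 2 with hP
  have hPlow : -N ^ 3 ≤ P := by
    have h1 : 0 ≤ ∑ v ∈ S, d' v ^ 2 := Finset.sum_nonneg fun v _ => sq_nonneg _
    have h2 : ∑ v ∈ S, d v ^ 2 ≤ ∑ v ∈ S, N ^ 2 :=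
      Finset.sum_le_sum fun v _ => pow_le_pow_left₀ (hdr v).1 (hdr v).2 2
    simp only [Finset.sum_const, nsmul_eq_mul, hN] at h2
    nlinarith
  have key : (∑ u ∈ S, c u) + (1 / ρ) * (P - E / ρ) ≤ (specRad G' - ρ) * ∑ v, (x v + z v) ^ 2 := by
    set T1 := ∑ u ∈ S, ∑ v ∈ S, (A' u v - A u v) * ((ξ u + c u) * (ξ v + c v))
    set T2 := ∑ u ∈ S, ∑ v ∈ S, A u v * (c u * c v)
    set T3 := ∑ u ∈ S, c u * (ξ u + c u)
    set T4 := ∑ v ∈ S, c v ^ 2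
    have i1 : (1 / ρ) * (P - N * (N * (4 * D ^ 2)) / ρ) ≤ (1 / ρ) * (2 * T3 - T4) :=
      mul_le_mul_of_nonneg_left b3 (by positivity)
    have i2 : (1 / ρ ^ 2) * (-(N ^ 2 * (2 * D + N) ^ 2)) ≤ (1 / ρ ^ 2) * T1 :=
      mul_le_mul_of_nonneg_left b1 (by positivity)
    have i3 : (1 / ρ ^ 2) * (-(N ^ 2 * N ^ 2)) ≤ (1 / ρ ^ 2) * T2 :=
      mul_le_mul_of_nonneg_left b2 (by positivity)
    have i4 : (1 / ρ) * (P - E / ρ) = (1 / ρ) * (P - N * (N * (4 * D ^ 2)) / ρ)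
        + (1 / ρ ^ 2) * (-(N ^ 2 * (2 * D + N) ^ 2)) + (1 / ρ ^ 2) * (-(N ^ 2 * N ^ 2)) := by
      rw [hE]; field_simp; ring
    have i5 : (1 / ρ) * (2 * T3 - T4) = 2 / ρ * T3 - 1 / ρ * T4 := by ring
    linarith
  have hEρ : E / ρ < 1 := by rw [div_lt_one hρ0]; linarith
  have hpos : 0 < (∑ u ∈ S, c u) + (1 / ρ) * (P - E / ρ) := by
    rw [hcs]
    rcases hsum with h | ⟨h1, h2⟩
    · have j1 : (-N ^ 3 - 1) / ρ ≤ (1 / ρ) * (P - E / ρ) := by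
        rw [div_eq_inv_mul, one_div]
        exact mul_le_mul_of_nonneg_left (by linarith) (by positivity)
      have j2 : -1 < (-N ^ 3 - 1) / ρ := by
        rw [lt_div_iff₀ hρ0]; linarith
      have : (∑ v ∈ S, d v) + 1 ≤ ∑ v ∈ S, d' v := h
      linarith
    · have h1' : (∑ v ∈ S, d v) = ∑ v ∈ S, d' v := h1
      have h2' : (∑ v ∈ S, d v ^ 2) + 1 ≤ ∑ v ∈ S, d' v ^ 2 := h2
      have : 0 < (1 / ρ) * (P - E / ρ) := by
        apply mul_pos (by positivity)
        linarith
      linarith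
  by_contra hcon
  push Not at hcon
  have : (specRad G' - ρ) * ∑ v, (x v + z v) ^ 2 ≤ 0 :=
    mul_nonpos_of_nonpos_of_nonneg (by linarith) hx2
  linarith
theorem minor_of_sub {V : Type} [DecidableEq V] (G : SimpleGraph V) (P Q : Finset V) (s t : ℕ)
    (hP : P.card = s) (hQ : Q.card = t) (h : ∀ p ∈ P, ∀ q ∈ Q, G.Adj p q) :
    MinorOf (completeBipartiteGraph (Fin s) (Fin t)) G := by
  let eP := (P.equivFinOfCardEq hP).symm
  let eQ := (Q.equivFinOfCardEq hQ).symm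
  let f : Fin s ⊕ Fin t → V := Sum.elim (fun i => (eP i : V)) (fun j => (eQ j : V))
  have hadj : ∀ i j, G.Adj (f (Sum.inl i)) (f (Sum.inr j)) := fun i j => h _ (eP i).2 _ (eQ j).2
  refine ⟨fun a => {f a}, ?_, ?_, ?_⟩
  · intro a
    have : Nonempty ({f a} : Set V) := ⟨⟨f a, rfl⟩⟩
    refine ⟨fun x y => ?_⟩
    have : x = y := Subsingleton.elim _ _
    rw [this]
  · intro a b hab
    show Disjoint ({f a} : Set V) {f b}
    rw [Set.disjoint_singleton]
    rcases a with i | i <;> rcases b with j | j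
    · intro he
      apply hab
      rw [eP.injective (Subtype.ext he)]
    · exact (hadj i j).ne
    · exact (hadj j i).ne'
    · intro he
      apply hab
      rw [eQ.injective (Subtype.ext he)]
  · intro a b hab
    refine ⟨f a, rfl, f b, rfl, ?_⟩
    rcases a with i | i <;> rcases b with j | j
    · simp at hab
    · exact hadj i j
    · exact (hadj j i).symm
    · simp at hab

theorem label_const {V L : Type} (G : SimpleGraph V) (X : Set V) (f : V → L)
    (hc : (G.induce X).Connected) (hf : ∀ u ∈ X, ∀ v ∈ X, G.Adj u v → f u = f v) :
    ∀ u ∈ X, ∀ v ∈ X, f u = f v := by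
  intro u hu v hv
  obtain ⟨w⟩ := hc.preconnected ⟨u, hu⟩ ⟨v, hv⟩
  have key : ∀ (a b : X), (G.induce X).Walk a b → f a = f b := by
    intro a b w
    induction w with
    | nil => rfl
    | @cons a b c h _ ih => rw [← ih]; exact hf a a.2 b b.2 h
  exact key _ _ w

theorem minor_transfer {V : Type} [Fintype V] [DecidableEq V] (G G' : SimpleGraph V) (K S : Finset V)
    (s t : ℕ) (hs : 1 ≤ s) (hst : s ≤ t) (hK : K.card = s - 1)
    (hclique : G.IsClique (↑K : Set V))
    (hSK : ∀ v ∈ S, v ∉ K)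
    (hSc : ∀ v ∈ S, ∀ u, G.Adj v u → u ∈ K ∨ u ∈ S)
    (hGG : ∀ u v, ¬ (u ∈ S ∧ v ∈ S) → (G'.Adj u v ↔ G.Adj u v))
    {L : Type} (p : V → L)
    (hp : ∀ u ∈ S, ∀ v ∈ S, G'.Adj u v → p u = p v)
    (hpc : ∀ l, ∃ T : Finset V, T.card ≤ t ∧ ∀ v ∈ S, p v = l → v ∈ T)
    (hm : MinorOf (completeBipartiteGraph (Fin s) (Fin t)) G') :
    MinorOf (completeBipartiteGraph (Fin s) (Fin t)) G := by
  classical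
  obtain ⟨φ, hφc, hφd, hφa⟩ := hm
  have hφne : ∀ a, (φ a).Nonempty := fun a => by
    obtain ⟨x⟩ := (hφc a).nonempty
    exact ⟨x, x.2⟩
  have huniq : ∀ a b v, v ∈ φ a → v ∈ φ b → a = b := by
    intro a b v ha hb
    by_contra hab
    exact Set.disjoint_left.1 (hφd hab) ha hb
  have hfree : ∀ (n : ℕ) (g : Fin n → Fin s ⊕ Fin t), Function.Injective g → s - 1 < n →
      ∃ i, ∀ v ∈ φ (g i), v ∉ K := by
    intro n g hg hn
    by_contra hcon
    push Not at hcon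
    choose k hk1 hk2 using hcon
    have hinj : Function.Injective k := by
      intro i j hij
      apply hg
      exact huniq _ _ (k i) (hk1 i) (hij ▸ hk1 j)
    have := Finset.card_le_card_of_injOn (s := (Finset.univ : Finset (Fin n))) (t := K) k
      (fun i _ => hk2 i) (fun i _ j _ h => hinj h)
    simp at this
    omega
  obtain ⟨i0, hi0⟩ := hfree s Sum.inl Sum.inl_injective (by omega)
  obtain ⟨j0, hj0⟩ := hfree t Sum.inr Sum.inr_injective (by omega)
  let f : V → Option L := fun v => if v ∈ S then some (p v) else none
  have hcross : ∀ u v, G'.Adj u v → u ∉ K → u ∉ S → v ∉ S := by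
    intro u v h hu hus hvs
    have h' := (hGG u v (fun h => hus h.1)).1 h
    rcases hSc v hvs u h'.symm with h | h
    · exact hu h
    · exact hus h
  have hf : ∀ u v, G'.Adj u v → u ∉ K → v ∉ K → f u = f v := by
    intro u v h hu hv
    by_cases hus : u ∈ S <;> by_cases hvs : v ∈ S
    · simp only [f, if_pos hus, if_pos hvs, hp u hus v hvs h]
    · exact absurd hus (hcross v u h.symm hv hvs)
    · exact absurd hvs (hcross u v h hu hus)
    · simp only [f, if_neg hus, if_neg hvs]
  have hfc : ∀ a, (∀ v ∈ φ a, v ∉ K) → ∀ u ∈ φ a, ∀ v ∈ φ a, f u = f v := by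
    intro a ha
    exact label_const G' (φ a) f (hφc a) (fun u hu v hv h => hf u v h (ha u hu) (ha v hv))
  have hfab : ∀ a b, (completeBipartiteGraph (Fin s) (Fin t)).Adj a b → (∀ v ∈ φ a, v ∉ K) →
      (∀ v ∈ φ b, v ∉ K) → ∀ u ∈ φ a, ∀ v ∈ φ b, f u = f v := by
    intro a b hab ha hb u hu v hv
    obtain ⟨x, hx, y, hy, hxy⟩ := hφa a b hab
    rw [hfc a ha u hu x hx, hf x y hxy (ha x hx) (hb y hy), hfc b hb y hy v hv]
  obtain ⟨v0, hv0⟩ := hφne (Sum.inl i0)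
  obtain ⟨w0, hw0⟩ := hφne (Sum.inr j0)
  have hall : ∀ a, (∀ v ∈ φ a, v ∉ K) → ∀ v ∈ φ a, f v = f v0 := by
    intro a ha v hv
    rcases a with i | j
    · rw [hfab (Sum.inl i) (Sum.inr j0) (by simp) ha hj0 v hv w0 hw0]
      exact (hfab (Sum.inl i0) (Sum.inr j0) (by simp) hi0 hj0 v0 hv0 w0 hw0).symm
    · exact (hfab (Sum.inl i0) (Sum.inr j) (by simp) hi0 ha v0 hv0 v hv).symm
  by_cases hv0S : v0 ∈ S
  · exfalso
    obtain ⟨T, hT, hTv⟩ := hpc (p v0)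
    have hex : ∀ a, ∃ v ∈ φ a, v ∈ K ∪ T := by
      intro a
      by_cases ha : ∀ v ∈ φ a, v ∉ K
      · obtain ⟨v, hv⟩ := hφne a
        refine ⟨v, hv, Finset.mem_union_right _ ?_⟩
        have h := hall a ha v hv
        simp only [f, if_pos hv0S] at h
        by_cases hvS : v ∈ S
        · rw [if_pos hvS] at h
          exact hTv v hvS (Option.some.inj h)
        · simp [hvS] at h
      · push Not at ha
        obtain ⟨v, hv, hvK⟩ := ha
        exact ⟨v, hv, Finset.mem_union_left _ hvK⟩
    choose g hg1 hg2 using hex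
    have := Finset.card_le_card_of_injOn (s := (Finset.univ : Finset (Fin s ⊕ Fin t))) (t := K ∪ T) g
      (fun i _ => hg2 i) (fun a _ b _ h => huniq a b (g a) (hg1 a) (h ▸ hg1 b))
    have h2 := Finset.card_union_le K T
    simp at this
    omega
  · have hout : ∀ a, (∀ v ∈ φ a, v ∉ K) → ∀ v ∈ φ a, v ∉ S := by
      intro a ha v hv hvS
      have h := hall a ha v hv
      simp [f, hvS, hv0S] at h
    refine ⟨fun a => φ a ∩ {v | v ∉ S}, ?_, ?_, ?_⟩
    · intro a
      by_cases ha : ∀ v ∈ φ a, v ∉ K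
      · have he : φ a ∩ {v | v ∉ S} = φ a := Set.inter_eq_left.2 (fun v hv => hout a ha v hv)
        show (G.induce (φ a ∩ {v | v ∉ S})).Connected
        rw [he]
        have hc := hφc a
        have : G.induce (φ a) = G'.induce (φ a) := by
          ext x y
          exact (hGG x y (fun h => hout a ha x x.2 h.1)).symm
        rw [this]
        exact hc
      · push Not at ha
        obtain ⟨k, hk, hkK⟩ := ha
        have hkS : k ∉ S := fun h => hSK k h hkK
        let k' : (φ a ∩ {v | v ∉ S} : Set V) := ⟨k, hk, hkS⟩
        have hreach : ∀ (x y : φ a), (G'.induce (φ a)).Walk x y → (y : V) = k → ∀ hx : (x : V) ∉ S,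
            (G.induce (φ a ∩ {v | v ∉ S})).Reachable ⟨x, x.2, hx⟩ k' := by
          intro x y w
          induction w with
          | nil =>
            rintro h hx
            have : (⟨_, Subtype.property _, hx⟩ : (φ a ∩ {v | v ∉ S} : Set V)) = k' := Subtype.ext h
            rw [this]
          | @cons x y z h w ih =>
            intro hz hx
            by_cases hxK : (x : V) ∈ K
            · by_cases hxk : (x : V) = k
              · have : (⟨x, x.2, hx⟩ : (φ a ∩ {v | v ∉ S} : Set V)) = k' := Subtype.ext hxk
                rw [this]
              · apply SimpleGraph.Adj.reachable
                exact hclique hxK hkK hxk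
            · have hyS : (y : V) ∉ S := hcross x y h hxK hx
              refine SimpleGraph.Reachable.trans (SimpleGraph.Adj.reachable ?_) (ih hz hyS)
              exact (hGG x y (fun h => hx h.1)).1 h
        have hr : ∀ x : (φ a ∩ {v | v ∉ S} : Set V), (G.induce (φ a ∩ {v | v ∉ S})).Reachable x k' := by
          intro x
          obtain ⟨w⟩ := (hφc a).preconnected ⟨x, x.2.1⟩ ⟨k, hk⟩
          exact hreach _ _ w rfl x.2.2
        have : Nonempty (φ a ∩ {v | v ∉ S} : Set V) := ⟨k'⟩
        exact ⟨fun x y => (hr x).trans (hr y).symm⟩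
    · intro a b hab
      exact (hφd hab).mono Set.inter_subset_left Set.inter_subset_left
    · intro a b hab
      by_cases ha : ∀ v ∈ φ a, v ∉ K
      · obtain ⟨x, hx, y, hy, hxy⟩ := hφa a b hab
        have hxS := hout a ha x hx
        exact ⟨x, ⟨hx, hxS⟩, y, ⟨hy, hcross x y hxy (ha x hx) hxS⟩, (hGG x y (fun h => hxS h.1)).1 hxy⟩
      · by_cases hb : ∀ v ∈ φ b, v ∉ K
        · obtain ⟨x, hx, y, hy, hxy⟩ := hφa a b hab
          have hyS := hout b hb y hy
          exact ⟨x, ⟨hx, hcross y x hxy.symm (hb y hy) hyS⟩, y, ⟨hy, hyS⟩, (hGG x y (fun h => hyS h.2)).1 hxy⟩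
        · push Not at ha hb
          obtain ⟨x, hx, hxK⟩ := ha
          obtain ⟨y, hy, hyK⟩ := hb
          refine ⟨x, ⟨hx, fun h => hSK x h hxK⟩, y, ⟨hy, fun h => hSK y h hyK⟩, hclique hxK hyK ?_⟩
          rintro rfl
          exact hab.ne (huniq a b x hx hy)
open Classical in
theorem comp_degsum {W : Type} [Fintype W] (F : SimpleGraph W) (c : F.ConnectedComponent) :
    2 * (Finset.univ.filter (fun v => F.connectedComponentMk v = c)).card ≤
      (∑ v ∈ Finset.univ.filter (fun v => F.connectedComponentMk v = c), F.degree v) + 2 := by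
  have hconn : (F.induce c.supp).Connected := c.connected_toSimpleGraph
  have h1 := hconn.card_vert_le_card_edgeSet_add_one
  have h2 := (F.induce c.supp).sum_degrees_eq_twice_card_edges
  have h3 : Nat.card c.supp = (Finset.univ.filter (fun v => F.connectedComponentMk v = c)).card := by
    rw [Nat.card_eq_fintype_card, Fintype.card_subtype]
    congr 1
    ext v
    simp
  have h4 : Nat.card (F.induce c.supp).edgeSet = (F.induce c.supp).edgeFinset.card := by
    rw [Nat.card_eq_fintype_card, SimpleGraph.edgeFinset_card]
  have h5 : ∑ v : c.supp, (F.induce c.supp).degree v =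
      ∑ v ∈ Finset.univ.filter (fun v => F.connectedComponentMk v = c), F.degree v := by
    calc ∑ v : c.supp, (F.induce c.supp).degree v = ∑ v : c.supp, F.degree v.1 := by
          apply Finset.sum_congr rfl
          intro v _
          apply SimpleGraph.degree_induce_of_neighborSet_subset
          intro u hu
          have hv := v.2
          rw [SimpleGraph.ConnectedComponent.mem_supp_iff] at hv ⊢
          rw [← hv]
          exact (SimpleGraph.ConnectedComponent.sound (SimpleGraph.Adj.reachable hu)).symm
      _ = _ := by
          rw [← Finset.sum_subtype (p := fun v => v ∈ c.supp) (s := Finset.univ.filter (fun v => F.connectedComponentMk v = c)) (f := fun v => F.degree v)]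
          intro x
          simp
  omega

open Classical in
theorem forest_bound {W : Type} [Fintype W] (F : SimpleGraph W) (s t b : ℕ) (hs : 2 ≤ s) (hst : s ≤ t)
    (hW : Fintype.card W = t + 1) (hb : b + 1 = (t + 1) / (s + 1))
    (hcomp : ∀ c : F.ConnectedComponent,
      s + 1 ≤ (Finset.univ.filter (fun v => F.connectedComponentMk v = c)).card)
    (hdeg : ∀ v, F.degree v + 1 ≤ t) :
    2 * t ≤ (∑ v, F.degree v) + 2 * b ∧
    ((∑ v, F.degree v) + 2 * b = 2 * t →
      ∑ v, (F.degree v : ℤ) ^ 2 < ((t : ℤ) - 2 * b) ^ 2 + t) := by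
  set k := Fintype.card F.ConnectedComponent with hk
  have hcard : ∑ c : F.ConnectedComponent, (Finset.univ.filter (fun v => F.connectedComponentMk v = c)).card = t + 1 := by
    rw [← hW, ← Finset.card_univ]
    exact (Finset.card_eq_sum_card_fiberwise (fun v _ => Finset.mem_univ _)).symm
  have hds : ∑ c : F.ConnectedComponent, ∑ v ∈ Finset.univ.filter (fun v => F.connectedComponentMk v = c), F.degree v = ∑ v, F.degree v :=
    Finset.sum_fiberwise _ _ _
  have hkσ : k * (s + 1) ≤ t + 1 := by
    rw [← hcard]
    calc k * (s + 1) = ∑ c : F.ConnectedComponent, (s + 1) := by simp [hk]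
      _ ≤ _ := Finset.sum_le_sum fun c _ => hcomp c
  have hkb : k ≤ b + 1 := by
    rw [hb]
    exact (Nat.le_div_iff_mul_le (by omega)).2 hkσ
  have hsum : 2 * (t + 1) ≤ (∑ v, F.degree v) + 2 * k := by
    rw [← hcard, ← hds, Finset.mul_sum]
    calc _ ≤ ∑ c : F.ConnectedComponent, ((∑ v ∈ Finset.univ.filter (fun v => F.connectedComponentMk v = c), F.degree v) + 2) :=
          Finset.sum_le_sum fun c _ => comp_degsum F c
      _ = _ := by
          rw [Finset.sum_add_distrib]
          simp [hk, mul_comm]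
  refine ⟨by omega, ?_⟩
  intro heq
  have hkeq : k = b + 1 := by omega
  have hbσ : (b + 1) * (s + 1) ≤ t + 1 := by rw [← hkeq]; exact hkσ
  have hd1 : ∀ v, 1 ≤ F.degree v := by
    intro v
    have h := hcomp (F.connectedComponentMk v)
    obtain ⟨w, hw, hwv⟩ := Finset.exists_mem_ne (lt_of_lt_of_le (by omega) h) v
    rw [Finset.mem_filter] at hw
    obtain ⟨p⟩ := SimpleGraph.ConnectedComponent.exact hw.2.symm
    cases p with
    | nil => exact absurd rfl hwv
    | cons h _ => exact (F.degree_pos_iff_exists_adj v).2 ⟨_, h⟩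
  have hd2 : ∀ v, F.degree v + b * (s + 1) ≤ t := by
    intro v
    have h1 : F.degree v + 1 ≤ (Finset.univ.filter (fun u => F.connectedComponentMk u = F.connectedComponentMk v)).card := by
      rw [← SimpleGraph.card_neighborFinset_eq_degree]
      rw [← Finset.card_insert_of_notMem (F.notMem_neighborFinset_self v)]
      apply Finset.card_le_card
      intro u hu
      rw [Finset.mem_insert] at hu
      rw [Finset.mem_filter]
      refine ⟨Finset.mem_univ _, ?_⟩
      rcases hu with rfl | hu
      · rfl
      · rw [SimpleGraph.mem_neighborFinset] at hu
        exact (SimpleGraph.ConnectedComponent.sound (SimpleGraph.Adj.reachable hu)).symm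
    have h2 := Finset.add_sum_erase Finset.univ (fun c => (Finset.univ.filter (fun u => F.connectedComponentMk u = c)).card) (Finset.mem_univ (F.connectedComponentMk v))
    have h3 : b * (s + 1) ≤ ∑ c ∈ Finset.univ.erase (F.connectedComponentMk v), (Finset.univ.filter (fun u => F.connectedComponentMk u = c)).card := by
      calc b * (s + 1) = ∑ c ∈ Finset.univ.erase (F.connectedComponentMk v), (s + 1) := by
            rw [Finset.sum_const, Finset.card_erase_of_mem (Finset.mem_univ _), Finset.card_univ, ← hk, hkeq]
            simp
        _ ≤ _ := Finset.sum_le_sum fun c _ => hcomp c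
    rw [hcard] at h2
    omega
  have hmain : ∀ r : ℤ, (∀ v, (F.degree v : ℤ) ≤ r) →
      ∑ v, (F.degree v : ℤ) ^ 2 ≤ (r + 1) * (2 * t - 2 * b) - r * (t + 1) := by
    intro r hr
    have h1 : 0 ≤ ∑ v, (((F.degree v : ℤ) - 1) * (r - F.degree v)) := by
      apply Finset.sum_nonneg
      intro v _
      apply mul_nonneg
      · have := hd1 v
        omega
      · linarith [hr v]
    have h2 : ∑ v, (((F.degree v : ℤ) - 1) * (r - F.degree v)) =
        (r + 1) * ∑ v, (F.degree v : ℤ) - ∑ v, (F.degree v : ℤ) ^ 2 - r * (t + 1) := by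
      have h4 : r * (t + 1) = ∑ v : W, r := by simp [hW]; ring
      rw [h4, Finset.mul_sum, ← Finset.sum_sub_distrib, ← Finset.sum_sub_distrib]
      exact Finset.sum_congr rfl fun v _ => by ring
    have h3 : ∑ v, (F.degree v : ℤ) = 2 * t - 2 * b := by
      have : ((∑ v, F.degree v : ℕ) : ℤ) + 2 * b = 2 * t := by exact_mod_cast heq
      push_cast at this
      linarith
    rw [h2, h3] at h1
    linarith
  rcases Nat.eq_zero_or_pos b with h0 | hpos
  · have h := hmain (t - 1) (fun v => by have := hdeg v; omega)
    subst h0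
    have : (2 : ℤ) ≤ t := by omega
    push_cast at h ⊢
    nlinarith
  · have h := hmain (t - b * (s + 1)) (fun v => by
      have := hd2 v
      have h' : ((F.degree v : ℤ)) + b * (s + 1) ≤ t := by exact_mod_cast this
      linarith)
    have hbσ' : ((b : ℤ) + 1) * (s + 1) ≤ t + 1 := by exact_mod_cast hbσ
    have hs' : (2 : ℤ) ≤ s := by exact_mod_cast hs
    have hb' : (1 : ℤ) ≤ b := by exact_mod_cast hpos
    have ht : (0 : ℤ) < t - 1 - 2 * b := by nlinarith
    have : (0 : ℤ) < b * ((s + 1 - 2) * (t - 1 - 2 * b)) := by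
      apply mul_pos (by linarith)
      apply mul_pos (by linarith) ht
    nlinarith
open Classical in
theorem adjMat_sum_eq {V : Type} [Fintype V] (G : SimpleGraph V) (S : Finset V) (v : V) :
    ∑ u ∈ S, adjMat G v u = ((S.filter (fun u => G.Adj v u)).card : ℝ) := by
  rw [Finset.card_filter]
  push_cast
  apply Finset.sum_congr rfl
  intro u _
  by_cases h : G.Adj v u
  · simp [h, adjMat_adj G h]
  · simp [h, adjMat_not_adj G h]

open Classical in
theorem small_comp_minor {V : Type} [Fintype V] (G : SimpleGraph V) (K A B : Finset V) (s t : ℕ)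
    (hs : 2 ≤ s) (hst : s ≤ t)
    (hK : K.card = s - 1) (hclique : G.IsClique (↑K : Set V))
    (hdom : ∀ v : V, v ∉ K → ∀ u ∈ K, G.Adj u v)
    (hAK : ∀ v ∈ A, v ∉ K) (hBK : ∀ v ∈ B, v ∉ K)
    (hA1 : 1 ≤ A.card) (hA2 : A.card ≤ s) (hAB : A.card + B.card = t + 1)
    (hadj : ∀ a ∈ A, ∀ b ∈ B, G.Adj a b) :
    MinorOf (completeBipartiteGraph (Fin s) (Fin t)) G := by
  obtain ⟨K1, hK1, hK1c⟩ := Finset.exists_subset_card_eq (s := K) (n := s - A.card) (by omega)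
  have hK2c : (K \ K1).card = A.card - 1 := by
    rw [Finset.card_sdiff_of_subset hK1]; omega
  apply minor_of_sub G (A ∪ K1) (B ∪ (K \ K1)) s t
  · rw [Finset.card_union_of_disjoint, hK1c]
    · omega
    · rw [Finset.disjoint_left]
      intro v hv hv2
      exact hAK v hv (hK1 hv2)
  · rw [Finset.card_union_of_disjoint, hK2c]
    · omega
    · rw [Finset.disjoint_left]
      intro v hv hv2
      exact hBK v hv (Finset.mem_sdiff.1 hv2).1
  · intro p hp q hq
    rw [Finset.mem_union] at hp hq
    rcases hp with hp | hp <;> rcases hq with hq | hq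
    · exact hadj p hp q hq
    · exact (hdom p (hAK p hp) q (Finset.mem_sdiff.1 hq).1).symm
    · exact hdom q (hBK q hq) p (hK1 hp)
    · apply hclique (hK1 hp) (Finset.mem_sdiff.1 hq).1
      rintro rfl
      exact (Finset.mem_sdiff.1 hq).2 hp

open Classical in
theorem degree_bound {V : Type} [Fintype V] (G : SimpleGraph V) (K : Finset V) (s t : ℕ)
    (hs : 2 ≤ s)
    (hmin : ¬ MinorOf (completeBipartiteGraph (Fin s) (Fin t)) G)
    (hK : K.card = s - 1)
    (hdom : ∀ v : V, v ∉ K → ∀ u ∈ K, G.Adj u v) (v : V) (hv : v ∉ K) :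
    (Kᶜ.filter (fun u => G.Adj v u)).card ≤ t := by
  by_contra hcon
  push Not at hcon
  obtain ⟨Q, hQ, hQc⟩ := Finset.exists_subset_card_eq hcon.le
  apply hmin
  apply minor_of_sub G (insert v K) Q s t
  · rw [Finset.card_insert_of_notMem hv]; omega
  · exact hQc
  · intro p hp q hq
    have h := Finset.mem_filter.1 (hQ hq)
    rw [Finset.mem_insert] at hp
    rcases hp with rfl | hp
    · exact h.2
    · exact hdom q (Finset.mem_compl.1 h.1) p hp

open Classical in
theorem piece_bound {V : Type} [Fintype V] (G : SimpleGraph V) (K T : Finset V) (s t b : ℕ)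
    (hs : 2 ≤ s) (hst : s ≤ t)
    (hmin : ¬ MinorOf (completeBipartiteGraph (Fin s) (Fin t)) G)
    (hK : K.card = s - 1) (hclique : G.IsClique (↑K : Set V))
    (hdom : ∀ v : V, v ∉ K → ∀ u ∈ K, G.Adj u v)
    (hb : b + 1 = (t + 1) / (s + 1))
    (hT : T.card = t + 1) (hTK : ∀ v ∈ T, v ∉ K)
    (hTn : ∀ v ∈ T, ∃ u ∈ T, G.Adj v u) :
    (∑ v ∈ T, ((T.filter (fun u => G.Adj v u)).card : ℤ) ≤ t * (t - 1) + 2 * b) ∧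
    (∑ v ∈ T, ((T.filter (fun u => G.Adj v u)).card : ℤ) = t * (t - 1) + 2 * b →
      ∑ v ∈ T, ((T.filter (fun u => G.Adj v u)).card : ℤ) ^ 2 < t * (t - 1) ^ 2 + (2 * b) ^ 2) := by
  obtain ⟨F, hFdef⟩ : ∃ F : SimpleGraph T, F = (G.comap (Subtype.val : T → V))ᶜ := ⟨_, rfl⟩
  have hW : Fintype.card T = t + 1 := by simp [hT]
  have hFdeg : ∀ v : T, (F.degree v : ℤ) = t - (T.filter (fun u => G.Adj v u)).card := by
    intro v
    have h1 : (G.comap (Subtype.val : T → V)).degree v = (T.filter (fun u => G.Adj v u)).card := by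
      rw [← SimpleGraph.card_neighborFinset_eq_degree]
      rw [← Finset.card_map (Function.Embedding.subtype _)]
      congr 1
      ext u
      simp
      tauto
    have h2 := (G.comap (Subtype.val : T → V)).degree_compl v
    have h3 := (G.comap (Subtype.val : T → V)).degree_lt_card_verts v
    have h4 : F.degree v = Fintype.card T - 1 - (G.comap (Subtype.val : T → V)).degree v := by
      rw [← h2]
      subst hFdef
      congr!
    rw [hW] at h3 h4
    omega
  have hpos : ∀ v ∈ T, 1 ≤ (T.filter (fun u => G.Adj v u)).card := by
    intro v hv
    obtain ⟨u, hu, huv⟩ := hTn v hv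
    exact Finset.card_pos.2 ⟨u, Finset.mem_filter.2 ⟨hu, huv⟩⟩
  have hF := forest_bound F s t b hs hst hW hb ?_ ?_
  · have e1 : ∑ v ∈ T, ((T.filter (fun u => G.Adj v u)).card : ℤ) = t * (t + 1) - ∑ v, (F.degree v : ℤ) := by
      simp_rw [hFdeg]
      rw [Finset.sum_sub_distrib, Finset.sum_coe_sort T (fun v => ((T.filter (fun u => G.Adj v u)).card : ℤ))]
      simp [hT]
      ring
    have e2 : ∑ v ∈ T, ((T.filter (fun u => G.Adj v u)).card : ℤ) ^ 2
        = t ^ 2 * (t + 1) - 2 * t * ∑ v, (F.degree v : ℤ) + ∑ v, (F.degree v : ℤ) ^ 2 := by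
      rw [← Finset.sum_coe_sort T (fun v => ((T.filter (fun u => G.Adj v u)).card : ℤ) ^ 2)]
      have : ∀ v : T, ((T.filter (fun u => G.Adj v u)).card : ℤ) = t - F.degree v := fun v => by
        rw [hFdeg]; ring
      simp_rw [this, sub_sq]
      rw [Finset.sum_add_distrib, Finset.sum_sub_distrib, ← Finset.mul_sum]
      simp [hT]
      ring
    have h1 : (2 * t : ℤ) ≤ (∑ v, (F.degree v : ℤ)) + 2 * b := by exact_mod_cast hF.1
    constructor
    · rw [e1]; linarith
    · intro he
      rw [e1] at he
      have h2 : (∑ v, (F.degree v : ℤ)) + 2 * b = 2 * t := by linarith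
      have h3 := hF.2 (by exact_mod_cast h2)
      rw [e2]
      have h4 : (∑ v, (F.degree v : ℤ)) = 2 * t - 2 * b := by linarith
      rw [h4]
      linarith
  · intro c
    by_contra hcon
    push Not at hcon
    set A0 := Finset.univ.filter (fun v => F.connectedComponentMk v = c) with hA0
    let A := A0.map (Function.Embedding.subtype _)
    let B := (A0ᶜ).map (Function.Embedding.subtype _)
    have hmemT : ∀ (X : Finset T) v, v ∈ X.map (Function.Embedding.subtype _) → v ∈ T := by
      intro X v hv
      rw [Finset.mem_map] at hv
      obtain ⟨w, _, rfl⟩ := hv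
      exact w.2
    apply hmin
    apply small_comp_minor G K A B s t hs hst hK hclique hdom
    · exact fun v hv => hTK v (hmemT _ v hv)
    · exact fun v hv => hTK v (hmemT _ v hv)
    · rw [Finset.card_map]
      apply Finset.card_pos.2
      obtain ⟨v, hv⟩ := c.nonempty_supp
      exact ⟨v, by simpa [hA0] using hv⟩
    · rw [Finset.card_map]; omega
    · rw [Finset.card_map, Finset.card_map, Finset.card_add_card_compl, hW]
    · intro a ha b hb
      rw [Finset.mem_map] at ha hb
      obtain ⟨a, ha, rfl⟩ := ha
      obtain ⟨b, hb, rfl⟩ := hb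
      rw [Finset.mem_compl] at hb
      by_contra hnadj
      apply hb
      rw [hA0, Finset.mem_filter] at ha ⊢
      refine ⟨Finset.mem_univ _, ?_⟩
      rw [← ha.2]
      by_cases hab : a = b
      · rw [hab]
      · apply SimpleGraph.ConnectedComponent.sound
        apply SimpleGraph.Adj.reachable
        apply SimpleGraph.Adj.symm
        rw [hFdef, SimpleGraph.compl_adj]
        exact ⟨hab, hnadj⟩
  · intro v
    have h1 := hFdeg v
    have h2 := hpos v v.2
    omega
theorem labels_exist {V : Type} [DecidableEq V] (S : Finset V) (m t : ℕ) (hS : S.card = m * (t + 1)) :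
    ∃ p : V → Option (Fin m), (∀ i, (S.filter (fun v => p v = some i)).card = t) ∧
      (S.filter (fun v => p v = none)).card = m := by
  classical
  have hc : Fintype.card S = Fintype.card (Fin m × Fin (t + 1)) := by simp [hS]
  let e : S ≃ Fin m × Fin (t + 1) := Fintype.equivOfCardEq hc
  let lab : Fin m × Fin (t + 1) → Option (Fin m) := fun q => if q.2 = Fin.last t then none else some q.1
  let p : V → Option (Fin m) := fun v => if h : v ∈ S then lab (e ⟨v, h⟩) else none
  have hfib : ∀ l, (S.filter (fun v => p v = l)).card = (Finset.univ.filter (fun q => lab q = l)).card := by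
    intro l
    symm
    apply Finset.card_bij (fun q _ => (e.symm q : V))
    · intro q hq
      rw [Finset.mem_filter] at hq ⊢
      refine ⟨(e.symm q).2, ?_⟩
      simp only [p, dif_pos (e.symm q).2]
      simpa using hq.2
    · intro q _ q' _ h
      exact e.symm.injective (Subtype.ext h)
    · intro v hv
      rw [Finset.mem_filter] at hv
      refine ⟨e ⟨v, hv.1⟩, ?_, by simp⟩
      rw [Finset.mem_filter]
      refine ⟨Finset.mem_univ _, ?_⟩
      have := hv.2
      simpa only [p, dif_pos hv.1] using this
  refine ⟨p, ?_, ?_⟩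
  · intro i
    rw [hfib]
    have : (Finset.univ.filter (fun q => lab q = some i)) = ({i} : Finset (Fin m)) ×ˢ (Finset.univ.erase (Fin.last t)) := by
      ext ⟨a, j⟩
      simp only [lab, Finset.mem_filter, Finset.mem_univ, true_and, Finset.mem_product, Finset.mem_singleton,
        Finset.mem_erase, and_true]
      by_cases hj : j = Fin.last t <;> simp [hj]
    rw [this, Finset.card_product]
    simp
  · rw [hfib]
    have : (Finset.univ.filter (fun q => lab q = none)) = (Finset.univ : Finset (Fin m)) ×ˢ {Fin.last t} := by
      ext ⟨a, j⟩
      simp [lab]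
      exact eq_comm
    rw [this, Finset.card_product]
    simp

theorem label_sum {V : Type} (S : Finset V) (m t : ℕ) (p : V → Option (Fin m))
    (h1 : ∀ i, (S.filter (fun v => p v = some i)).card = t)
    (h2 : (S.filter (fun v => p v = none)).card = m) (g : Option (Fin m) → ℤ) (x y : ℤ)
    (hx : ∀ i, g (some i) = x) (hy : g none = y) :
    ∑ v ∈ S, g (p v) = m * (t * x + y) := by
  rw [← Finset.sum_fiberwise S p (fun v => g (p v))]
  have : ∀ l, ∑ v ∈ S.filter (fun v => p v = l), g (p v) = (S.filter (fun v => p v = l)).card * g l := by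
    intro l
    rw [Finset.sum_congr rfl (g := fun _ => g l) (fun v hv => by rw [(Finset.mem_filter.1 hv).2])]
    simp
  simp_rw [this]
  rw [Fintype.sum_option, h2, hy]
  simp_rw [h1, hx]
  simp
  ring

/-- Lemma 4.2: at most 2β − 2 components of G⋆ − K have exactly t+1 vertices. -/
theorem few_components_t_plus_one (s t : ℕ) (ht : 4 ≤ t) (hs : 2 ≤ s) (hst : s ≤ t) :
    ∃ n₀ : ℕ, ∀ n : ℕ, n₀ ≤ n →
    ∀ (G : SimpleGraph (Fin n)) (K : Finset (Fin n)),
      ¬ MinorOf (completeBipartiteGraph (Fin s) (Fin t)) G →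
      (∀ G' : SimpleGraph (Fin n),
        ¬ MinorOf (completeBipartiteGraph (Fin s) (Fin t)) G' → specRad G' ≤ specRad G) →
      K.card = s - 1 → G.IsClique (↑K : Set (Fin n)) →
      (∀ v : Fin n, v ∉ K → ∀ u ∈ K, G.Adj u v) →
      {c : (G.comap (Subtype.val : {v : Fin n // v ∉ K} → Fin n)).ConnectedComponent |
        c.supp.ncard = t + 1}.ncard ≤ 2 * ((t+1)/(s+1)) - 2 := by
  classical
  obtain ⟨b, hb⟩ : ∃ b, b + 1 = (t + 1) / (s + 1) := by
    have : 1 ≤ (t + 1) / (s + 1) := (Nat.le_div_iff_mul_le (by omega)).2 (by omega)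
    exact ⟨(t + 1) / (s + 1) - 1, by omega⟩
  have hbt : 2 * b + 1 ≤ t := by
    have h1 : (b + 1) * (s + 1) ≤ t + 1 := by rw [hb]; exact Nat.div_mul_le_self _ _
    nlinarith
  set m := 2 * b + 1 with hm
  obtain ⟨N, hN⟩ : ∃ N : ℝ, N = ((m * (t + 1) : ℕ) : ℝ) := ⟨_, rfl⟩
  obtain ⟨C, hC⟩ : ∃ C : ℝ, C = 2 * (t : ℝ) + 1 + N ^ 3 + (N ^ 2 * (2 * (t : ℝ) + N) ^ 2 + N ^ 2 * N ^ 2 + N * (N * (4 * (t : ℝ) ^ 2))) := ⟨_, rfl⟩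
  have hN0 : 0 ≤ N := by rw [hN]; positivity
  have hC0 : 0 ≤ C := by rw [hC]; positivity
  refine ⟨⌈(C + 1) ^ 2⌉₊ + 1, ?_⟩
  intro n hn G K hmin hmax hK hclique hdom
  by_contra hcon
  push Not at hcon
  have hn0 : 0 < n := by omega
  have : Nonempty (Fin n) := ⟨⟨0, hn0⟩⟩
  have hρ : C < specRad G := by
    obtain ⟨k, hk⟩ := Finset.card_pos.1 (by omega : 0 < K.card)
    have h := specRad_lower G k (fun v hv => by
      by_cases hvK : v ∈ K
      · exact hclique hk hvK hv.symm
      · exact hdom v hvK k hk) (C + 1) (by linarith) (by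
        have h1 : (C + 1) ^ 2 ≤ ⌈(C + 1) ^ 2⌉₊ := Nat.le_ceil _
        have h2 : ((⌈(C + 1) ^ 2⌉₊ + 1 : ℕ) : ℝ) ≤ n := by exact_mod_cast hn
        push_cast at h2
        simp only [Fintype.card_fin]
        linarith)
    linarith
  set L := G.comap (Subtype.val : {v : Fin n // v ∉ K} → Fin n) with hL
  have hfin : {c : L.ConnectedComponent | c.supp.ncard = t + 1}.Finite := Set.toFinite _
  rw [Set.ncard_eq_toFinset_card _ hfin] at hcon
  obtain ⟨Cs, hCs, hCsc⟩ := Finset.exists_subset_card_eq (n := m) (by omega : m ≤ hfin.toFinset.card)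
  have hCs' : ∀ c ∈ Cs, c.supp.ncard = t + 1 := fun c hc => by
    simpa using hCs hc
  let T : L.ConnectedComponent → Finset (Fin n) := fun c =>
    Finset.univ.filter (fun v => ∃ h : v ∉ K, L.connectedComponentMk ⟨v, h⟩ = c)
  have hTmem : ∀ c v, v ∈ T c ↔ ∃ h : v ∉ K, L.connectedComponentMk ⟨v, h⟩ = c := by
    intro c v; simp [T]
  have hTK : ∀ c, ∀ v ∈ T c, v ∉ K := fun c v hv => ((hTmem c v).1 hv).1
  have hTcard : ∀ c ∈ Cs, (T c).card = t + 1 := by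
    intro c hc
    rw [← hCs' c hc, ← Set.ncard_image_of_injective _ Subtype.val_injective, ← Set.ncard_coe_finset]
    congr 1
    ext v
    simp [T]
  have hTclosed : ∀ c, ∀ v ∈ T c, ∀ u, u ∉ K → G.Adj v u → u ∈ T c := by
    intro c v hv u hu h
    obtain ⟨hvK, hvc⟩ := (hTmem c v).1 hv
    rw [hTmem]
    refine ⟨hu, ?_⟩
    rw [← hvc]
    apply SimpleGraph.ConnectedComponent.sound
    apply SimpleGraph.Adj.reachable
    exact h.symm
  have hTn : ∀ c ∈ Cs, ∀ v ∈ T c, ∃ u ∈ T c, G.Adj v u := by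
    intro c hc v hv
    obtain ⟨w, hw, hwv⟩ := Finset.exists_mem_ne (by rw [hTcard c hc]; omega : 1 < (T c).card) v
    obtain ⟨hvK, hvc⟩ := (hTmem c v).1 hv
    obtain ⟨hwK, hwc⟩ := (hTmem c w).1 hw
    obtain ⟨q⟩ := SimpleGraph.ConnectedComponent.exact (hvc.trans hwc.symm)
    cases q with
    | nil => exact absurd rfl hwv
    | @cons _ x _ h _ => exact ⟨x.1, hTclosed c v hv x.1 x.2 h, h⟩
  have hTdisj : (↑Cs : Set L.ConnectedComponent).PairwiseDisjoint T := by
    intro c _ c' _ hcc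
    show Disjoint (T c) (T c')
    rw [Finset.disjoint_left]
    intro v hv hv'
    obtain ⟨h1, h2⟩ := (hTmem c v).1 hv
    obtain ⟨h3, h4⟩ := (hTmem c' v).1 hv'
    exact hcc (h2.symm.trans h4)
  set S := Cs.biUnion T with hS
  have hScard : S.card = m * (t + 1) := by
    rw [hS, Finset.card_biUnion hTdisj, Finset.sum_congr rfl hTcard]
    simp [hCsc]
  have hSK : ∀ v ∈ S, v ∉ K := by
    intro v hv
    obtain ⟨c, _, hv⟩ := Finset.mem_biUnion.1 hv
    exact hTK c v hv
  have hSc : ∀ v ∈ S, ∀ u, G.Adj v u → u ∈ K ∨ u ∈ S := by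
    intro v hv u h
    obtain ⟨c, hc, hv⟩ := Finset.mem_biUnion.1 hv
    by_cases hu : u ∈ K
    · exact Or.inl hu
    · exact Or.inr (Finset.mem_biUnion.2 ⟨c, hc, hTclosed c v hv u hu h⟩)
  have hdegT : ∀ c ∈ Cs, ∀ v ∈ T c, (S.filter (fun u => G.Adj v u)).card = ((T c).filter (fun u => G.Adj v u)).card := by
    intro c hc v hv
    congr 1
    ext u
    simp only [Finset.mem_filter]
    constructor
    · rintro ⟨h1, h2⟩
      exact ⟨hTclosed c v hv u (hSK u h1) h2, h2⟩
    · rintro ⟨h1, h2⟩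
      exact ⟨Finset.mem_biUnion.2 ⟨c, hc, h1⟩, h2⟩
  obtain ⟨p, hp1, hp2⟩ := labels_exist S m t hScard
  let G' : SimpleGraph (Fin n) :=
    { Adj := fun u v => u ≠ v ∧ ((u ∈ S ∧ v ∈ S ∧ p u = p v) ∨ (¬ (u ∈ S ∧ v ∈ S) ∧ G.Adj u v))
      symm := ⟨fun u v h => by
        refine ⟨h.1.symm, ?_⟩
        rcases h.2 with ⟨h1, h2, h3⟩ | ⟨h1, h2⟩
        · exact Or.inl ⟨h2, h1, h3.symm⟩
        · exact Or.inr ⟨fun h => h1 ⟨h.2, h.1⟩, h2.symm⟩⟩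
      loopless := ⟨fun u h => h.1 rfl⟩ }
  have hG'S : ∀ u ∈ S, ∀ v ∈ S, (G'.Adj u v ↔ u ≠ v ∧ p u = p v) := by
    intro u hu v hv
    show (u ≠ v ∧ ((u ∈ S ∧ v ∈ S ∧ p u = p v) ∨ (¬ (u ∈ S ∧ v ∈ S) ∧ G.Adj u v))) ↔ _
    tauto
  have hGG : ∀ u v, ¬ (u ∈ S ∧ v ∈ S) → (G'.Adj u v ↔ G.Adj u v) := by
    intro u v h
    show (u ≠ v ∧ ((u ∈ S ∧ v ∈ S ∧ p u = p v) ∨ (¬ (u ∈ S ∧ v ∈ S) ∧ G.Adj u v))) ↔ _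
    have : G.Adj u v → u ≠ v := fun h => h.ne
    tauto
  have hmin' : ¬ MinorOf (completeBipartiteGraph (Fin s) (Fin t)) G' := by
    intro hmm
    apply hmin
    refine minor_transfer G G' K S s t (by omega) hst hK hclique hSK hSc hGG p
      (fun u hu v hv h => ((hG'S u hu v hv).1 h).2) ?_ hmm
    intro l
    refine ⟨S.filter (fun v => p v = l), ?_, fun v hv h => Finset.mem_filter.2 ⟨hv, h⟩⟩
    rcases l with _ | i
    · rw [hp2]; exact hbt
    · rw [hp1]
  have hle := hmax G' hmin'
  apply absurd hle
  push Not
  have hnewdeg : ∀ v ∈ S, ((S.filter (fun u => G'.Adj v u)).card : ℤ) = ((S.filter (fun u => p u = p v)).card : ℤ) - 1 := by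
    intro v hv
    have h1 : S.filter (fun u => G'.Adj v u) = (S.filter (fun u => p u = p v)).erase v := by
      ext u
      simp only [Finset.mem_filter, Finset.mem_erase]
      constructor
      · rintro ⟨h1, h2⟩
        have := (hG'S v hv u h1).1 h2
        exact ⟨this.1.symm, h1, this.2.symm⟩
      · rintro ⟨h1, h2, h3⟩
        exact ⟨h2, (hG'S v hv u h2).2 ⟨h1.symm, h3.symm⟩⟩
    have h2 : v ∈ S.filter (fun u => p u = p v) := Finset.mem_filter.2 ⟨hv, rfl⟩
    rw [h1, Finset.card_erase_of_mem h2]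
    have := Finset.card_pos.2 ⟨v, h2⟩
    omega
  have hmz : (m : ℤ) = 2 * b + 1 := by rw [hm]; push_cast; ring
  have hnew1 : ∑ v ∈ S, ((S.filter (fun u => G'.Adj v u)).card : ℤ) = m * (t * (t - 1) + 2 * b) := by
    rw [Finset.sum_congr rfl hnewdeg]
    exact label_sum S m t p hp1 hp2 (fun l => ((S.filter (fun u => p u = l)).card : ℤ) - 1) _ _
      (fun i => by simp only [hp1]) (by simp only [hp2]; linarith)
  have hnew2 : ∑ v ∈ S, ((S.filter (fun u => G'.Adj v u)).card : ℤ) ^ 2 = m * (t * (t - 1) ^ 2 + (2 * b) ^ 2) := by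
    rw [Finset.sum_congr rfl (fun v hv => by rw [hnewdeg v hv])]
    exact label_sum S m t p hp1 hp2 (fun l => (((S.filter (fun u => p u = l)).card : ℤ) - 1) ^ 2) _ _
      (fun i => by simp only [hp1]) (by simp only [hp2]; congr 1; linarith)
  have hpiece := fun c (hc : c ∈ Cs) => piece_bound G K (T c) s t b hs hst hmin hK hclique hdom hb (hTcard c hc) (hTK c) (hTn c hc)
  have hold1 : ∑ v ∈ S, ((S.filter (fun u => G.Adj v u)).card : ℤ) = ∑ c ∈ Cs, ∑ v ∈ T c, (((T c).filter (fun u => G.Adj v u)).card : ℤ) := by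
    rw [hS, Finset.sum_biUnion hTdisj]
    exact Finset.sum_congr rfl fun c hc => Finset.sum_congr rfl fun v hv => by rw [← hS, hdegT c hc v hv]
  have hold2 : ∑ v ∈ S, ((S.filter (fun u => G.Adj v u)).card : ℤ) ^ 2 = ∑ c ∈ Cs, ∑ v ∈ T c, (((T c).filter (fun u => G.Adj v u)).card : ℤ) ^ 2 := by
    rw [hS, Finset.sum_biUnion hTdisj]
    exact Finset.sum_congr rfl fun c hc => Finset.sum_congr rfl fun v hv => by rw [← hS, hdegT c hc v hv]
  have hCsum : ∀ x : ℤ, (m : ℤ) * x = ∑ c ∈ Cs, x := by intro x; simp [hCsc]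
  have hCsne : Cs.Nonempty := Finset.card_pos.1 (by omega)
  have hle1 : ∑ v ∈ S, ((S.filter (fun u => G.Adj v u)).card : ℤ) ≤ ∑ v ∈ S, ((S.filter (fun u => G'.Adj v u)).card : ℤ) := by
    rw [hold1, hnew1, hCsum]
    exact Finset.sum_le_sum fun c hc => (hpiece c hc).1
  have hlt2 : ∑ v ∈ S, ((S.filter (fun u => G.Adj v u)).card : ℤ) = ∑ v ∈ S, ((S.filter (fun u => G'.Adj v u)).card : ℤ) →
      ∑ v ∈ S, ((S.filter (fun u => G.Adj v u)).card : ℤ) ^ 2 < ∑ v ∈ S, ((S.filter (fun u => G'.Adj v u)).card : ℤ) ^ 2 := by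
    intro heq
    rw [hold1, hnew1, hCsum] at heq
    have hall := (Finset.sum_eq_sum_iff_of_le (fun c hc => (hpiece c hc).1)).1 heq
    rw [hold2, hnew2, hCsum]
    exact Finset.sum_lt_sum_of_nonempty hCsne fun c hc => (hpiece c hc).2 (hall c hc)
  refine spectral_compare G G' K S (t : ℝ) N (by positivity) hdom ?_ hSK hSc hGG (by rw [hScard, hN]) (by rw [← hC]; exact hρ) ?_
  · intro v hv
    have h := degree_bound G K s t hs hmin hK hdom v hv
    rw [adjMat_sum_eq]
    refine le_trans (le_of_eq ?_) ((Nat.cast_le (α := ℝ)).2 h)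
    congr!
  · have e1 : ∀ v, ∑ u ∈ S, adjMat G v u = ((S.filter (fun u => G.Adj v u)).card : ℝ) := by
      intro v
      rw [adjMat_sum_eq]
    have e2 : ∀ v, ∑ u ∈ S, adjMat G' v u = ((S.filter (fun u => G'.Adj v u)).card : ℝ) := by
      intro v
      rw [adjMat_sum_eq]
      congr!
    simp only [e1, e2]
    rcases hle1.lt_or_eq with h | h
    · left
      exact_mod_cast Int.add_one_le_iff.2 h
    · right
      refine ⟨by exact_mod_cast h, ?_⟩
      exact_mod_cast Int.add_one_le_iff.2 (hlt2 h)
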